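/- arXiv:2212.02680 — 4 statements merged into one kernel-verified Lean document; each statement's English description precedes it below -/
import Mathlib

section
/- Let X be a compact metric space and let P and Q be weak*-compact sets of Borel probability measures on X. Then the minimum over P in the closed convex hull of P and Q in the closed convex hull of Q of the total variation norm ‖P − Q‖₁ (this minimum is attained) equals the supremum, over continuous functions f : X → ℝ with ‖f‖_∞ ≤ 1, of min over P ∈ P and Q ∈ Q of (∫_X f dP − ∫_X f dQ). -/
open MeasureTheory
open scoped NNReal

noncomputable section

/-- Total variation distance between two finite measures. -/
def tvDist {X : Type*} [MeasurableSpace X] (P Q : FiniteMeasure X) : ℝ :=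
  ((P.toMeasure.toSignedMeasure - Q.toMeasure.toSignedMeasure).totalVariation Set.univ).toReal

/-- Closed convex hull (weak* topology) of a set of probability measures, inside finite measures. -/
def cchull {X : Type*} [MeasurableSpace X] [TopologicalSpace X] [OpensMeasurableSpace X]
    (S : Set (ProbabilityMeasure X)) : Set (FiniteMeasure X) :=
  closure (convexHull ℝ≥0 (ProbabilityMeasure.toFiniteMeasure '' S))

section TotalVariation

variable {X : Type*} [MeasurableSpace X]

theorem tvDist_eq_measureReal_sub_add (P Q : FiniteMeasure X) :
    tvDist P Q = ((P : Measure X) - (Q : Measure X)).real Set.univ +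
      ((Q : Measure X) - (P : Measure X)).real Set.univ := by
  rw [tvDist, SignedMeasure.totalVariation, Measure.toJordanDecomposition_toSignedMeasure_sub,
    Measure.jordanDecompositionOfToSignedMeasureSub_posPart,
    Measure.jordanDecompositionOfToSignedMeasureSub_negPart, Measure.add_apply,
    ENNReal.toReal_add (measure_ne_top _ _) (measure_ne_top _ _)]
  rfl

theorem measure_add_sub_comm (μ ν : Measure X) [IsFiniteMeasure μ] [IsFiniteMeasure ν] :
    μ + (ν - μ) = ν + (μ - ν) := by
  rw [← Measure.toSignedMeasure_eq_toSignedMeasure_iff, Measure.toSignedMeasure_add,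
    Measure.toSignedMeasure_add, add_comm ν.toSignedMeasure, ← sub_eq_sub_iff_add_eq_add]
  exact Measure.sub_toSignedMeasure_eq_toSignedMeasure_sub

theorem integral_sub_integral_eq_measure_sub {μ ν : Measure X} [IsFiniteMeasure μ]
    [IsFiniteMeasure ν] {f : X → ℝ} (hμ : Integrable f μ) (hν : Integrable f ν) :
    ∫ x, f x ∂μ - ∫ x, f x ∂ν = ∫ x, f x ∂(μ - ν) - ∫ x, f x ∂(ν - μ) := by
  have hμν : Integrable f (μ - ν) := hμ.mono_measure Measure.sub_le
  have hνμ : Integrable f (ν - μ) := hν.mono_measure Measure.sub_le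
  have h := congrArg (fun m ↦ ∫ x, f x ∂m) (measure_add_sub_comm μ ν)
  simp only [integral_add_measure hμ hνμ, integral_add_measure hν hμν] at h
  linarith

variable [TopologicalSpace X] [CompactSpace X]

theorem ContinuousMap.abs_integral_le [OpensMeasurableSpace X] (f : C(X, ℝ)) (hf : ‖f‖ ≤ 1)
    (μ : Measure X) [IsFiniteMeasure μ] : |∫ x, f x ∂μ| ≤ μ.real Set.univ := by
  simpa using norm_integral_le_of_norm_le_const (μ := μ) (C := 1)
    (Filter.Eventually.of_forall fun x ↦ (f.norm_coe_le_norm x).trans hf)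

theorem ContinuousMap.integrable_of_finite [OpensMeasurableSpace X] (f : C(X, ℝ))
    (μ : Measure X) [IsFiniteMeasure μ] : Integrable f μ :=
  (BoundedContinuousFunction.mkOfCompact f).integrable μ

/-- Integration against a finite measure, as a continuous linear functional on `C(X, ℝ)`. -/
def ContinuousMap.integralCLM [OpensMeasurableSpace X] (μ : Measure X) [IsFiniteMeasure μ] :
    C(X, ℝ) →L[ℝ] ℝ :=
  LinearMap.mkContinuous
    { toFun f := ∫ x, f x ∂μ
      map_add' f g := integral_add (f.integrable_of_finite μ) (g.integrable_of_finite μ)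
      map_smul' c f := integral_const_mul c f }
    (μ.real Set.univ) fun f ↦ (norm_integral_le_of_norm_le_const (μ := μ)
      (Filter.Eventually.of_forall f.norm_coe_le_norm)).trans_eq (mul_comm _ _)

theorem integral_sub_integral_le_tvDist [OpensMeasurableSpace X] (P Q : FiniteMeasure X)
    (f : C(X, ℝ)) (hf : ‖f‖ ≤ 1) :
    ∫ x, f x ∂(P : Measure X) - ∫ x, f x ∂(Q : Measure X) ≤ tvDist P Q := by
  rw [tvDist_eq_measureReal_sub_add, integral_sub_integral_eq_measure_sub
    (f.integrable_of_finite _) (f.integrable_of_finite _)]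
  have h₁ := (abs_le.1 (f.abs_integral_le hf ((P : Measure X) - (Q : Measure X)))).2
  have h₂ := (abs_le.1 (f.abs_integral_le hf ((Q : Measure X) - (P : Measure X)))).1
  linarith

theorem abs_sub_clamp_le {a b : ℝ} (ha : |a| ≤ 1) : |a - max (-1) (min 1 b)| ≤ |a - b| := by
  rw [abs_le] at ha
  rcases max_cases (-1) (min 1 b) with h | h <;> rcases min_cases 1 b with h' | h' <;>
    rw [h.1] <;> cases abs_cases (a - b) <;> rw [abs_le] <;> constructor <;> linarith

/-- The total variation distance is the supremum of the differences of integrals of continuous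
functions in the unit ball. -/
theorem exists_lt_integral_sub_integral_of_lt_tvDist [R1Space X] [BorelSpace X]
    (P Q : FiniteMeasure X) [((P : Measure X) - Q + (Q - P)).Regular]
    {t : ℝ} (ht : t < tvDist P Q) :
    ∃ f : C(X, ℝ), ‖f‖ ≤ 1 ∧
      t < ∫ x, f x ∂(P : Measure X) - ∫ x, f x ∂(Q : Measure X) := by
  rw [tvDist_eq_measureReal_sub_add] at ht
  obtain ⟨s, hs, hs₁, hs₂⟩ :=
    Measure.mutually_singular_measure_sub (μ := (P : Measure X)) (ν := (Q : Measure X))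
  set A := (P : Measure X) - (Q : Measure X)
  set B := (Q : Measure X) - (P : Measure X)
  let h : X → ℝ := fun x ↦ 1 - 2 * s.indicator 1 x
  have hle (x : X) : |h x| ≤ 1 := by
    by_cases hx : x ∈ s <;> norm_num [h, hx]
  have hmeas : Measurable h :=
    measurable_const.sub ((measurable_one.indicator hs).const_mul 2)
  have hint (μ : Measure X) [IsFiniteMeasure μ] : Integrable h μ :=
    .of_bound hmeas.aestronglyMeasurable 1 (.of_forall hle)
  have hA : ∫ x, h x ∂A = A.real Set.univ := by
    have : h =ᵐ[A] fun _ ↦ 1 := by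
      filter_upwards [measure_eq_zero_iff_ae_notMem.1 hs₁] with x hx
      simp [h, hx]
    simp [integral_congr_ae this]
  have hB : ∫ x, h x ∂B = - B.real Set.univ := by
    have : h =ᵐ[B] fun _ ↦ -1 := by
      filter_upwards [measure_eq_zero_iff_ae_notMem.1 hs₂] with x hx
      norm_num [h, Set.notMem_compl_iff.1 hx]
    simp [integral_congr_ae this]
  obtain ⟨g, -, hg, hgc, hgi⟩ := (hint (A + B)).exists_hasCompactSupport_integral_sub_le
    (half_pos (sub_pos.2 ht))
  let f : C(X, ℝ) := ⟨fun x ↦ max (-1) (min 1 (g x)), by fun_prop⟩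
  have hf : ‖f‖ ≤ 1 := (ContinuousMap.norm_le _ zero_le_one).2 fun x ↦ abs_le.2
    ⟨le_max_left _ _, max_le (by norm_num) (min_le_left _ _)⟩
  have happrox : ∫ x, |h x - f x| ∂(A + B) ≤ ∫ x, ‖h x - g x‖ ∂(A + B) :=
    integral_mono ((hint _).sub (f.integrable_of_finite _)).abs ((hint _).sub hgi).norm
      fun x ↦ abs_sub_clamp_le (hle x)
  have habs (μ : Measure X) [IsFiniteMeasure μ] : Integrable (fun x ↦ |h x - f x|) μ :=
    ((hint μ).sub (f.integrable_of_finite μ)).abs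
  rw [integral_add_measure (habs A) (habs B)] at happrox
  have hfA := (le_abs_self _).trans (abs_integral_le_integral_abs (f := fun x ↦ h x - f x) (μ := A))
  have hfB := (neg_le_abs _).trans (abs_integral_le_integral_abs (f := fun x ↦ h x - f x) (μ := B))
  rw [integral_sub (hint _) (f.integrable_of_finite _)] at hfA hfB
  refine ⟨f, hf, ?_⟩
  rw [integral_sub_integral_eq_measure_sub (f.integrable_of_finite _) (f.integrable_of_finite _)]
  linarith

end TotalVariation

section Hull

variable {X : Type*} [MeasurableSpace X] [TopologicalSpace X] [OpensMeasurableSpace X]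

theorem convex_cchull_combination {S : Set (ProbabilityMeasure X)} {μ ν : FiniteMeasure X}
    (hμ : μ ∈ cchull S) (hν : ν ∈ cchull S) {a b : ℝ≥0} (hab : a + b = 1) :
    a • μ + b • ν ∈ cchull S :=
  map_mem_closure₂ (f := fun μ ν : FiniteMeasure X ↦ a • μ + b • ν) (by fun_prop) hμ hν
    fun _ hx _ hy ↦ convex_convexHull ℝ≥0 _ hx hy zero_le zero_le hab

theorem toFiniteMeasure_mem_cchull {S : Set (ProbabilityMeasure X)} {P : ProbabilityMeasure X}
    (hP : P ∈ S) : P.toFiniteMeasure ∈ cchull S :=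
  subset_closure (subset_convexHull ℝ≥0 _ ⟨P, hP, rfl⟩)

theorem cchull_subset {S : Set (ProbabilityMeasure X)} {C : Set (FiniteMeasure X)}
    (hC : Convex ℝ≥0 C) (hC' : IsClosed C) (h : ∀ P ∈ S, P.toFiniteMeasure ∈ C) :
    cchull S ⊆ C :=
  closure_minimal (convexHull_min (Set.image_subset_iff.2 h) hC) hC'

variable [CompactSpace X]

theorem integral_smul_add_smul (f : C(X, ℝ)) (μ ν : FiniteMeasure X) (a b : ℝ≥0) :
    ∫ x, f x ∂((a • μ + b • ν : FiniteMeasure X) : Measure X) =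
      a * ∫ x, f x ∂(μ : Measure X) + b * ∫ x, f x ∂(ν : Measure X) := by
  rw [FiniteMeasure.toMeasure_add, FiniteMeasure.toMeasure_smul, FiniteMeasure.toMeasure_smul,
    integral_add_measure (f.integrable_of_finite _) (f.integrable_of_finite _),
    integral_smul_nnreal_measure, integral_smul_nnreal_measure]
  rfl

theorem le_integral_of_mem_cchull {S : Set (ProbabilityMeasure X)} (f : C(X, ℝ)) {c : ℝ}
    (h : ∀ P ∈ S, c ≤ ∫ x, f x ∂(P : Measure X)) {μ : FiniteMeasure X} (hμ : μ ∈ cchull S) :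
    c ≤ ∫ x, f x ∂(μ : Measure X) := by
  refine cchull_subset (C := {μ | c ≤ ∫ x, f x ∂(μ : Measure X)}) ?_
    (isClosed_le continuous_const (FiniteMeasure.continuous_integral_continuousMap f)) h hμ
  intro μ hμ ν hν a b _ _ hab
  have hab' : (a : ℝ) + b = 1 := by exact_mod_cast hab
  simp only [Set.mem_ofPred_eq, integral_smul_add_smul] at *
  calc c = a * c + b * c := by rw [← add_mul, hab', one_mul]
    _ ≤ _ := by gcongr

theorem le_integral_sub_integral_of_mem_cchull {S T : Set (ProbabilityMeasure X)} (f : C(X, ℝ))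
    {c : ℝ} (h : ∀ P ∈ S, ∀ Q ∈ T, c ≤ ∫ x, f x ∂(P : Measure X) - ∫ x, f x ∂(Q : Measure X))
    {μ ν : FiniteMeasure X} (hμ : μ ∈ cchull S) (hν : ν ∈ cchull T) :
    c ≤ ∫ x, f x ∂(μ : Measure X) - ∫ x, f x ∂(ν : Measure X) := by
  have hST : ∀ Q ∈ T, c + ∫ x, f x ∂(Q : Measure X) ≤ ∫ x, f x ∂(μ : Measure X) := fun Q hQ ↦
    le_integral_of_mem_cchull f (fun P hP ↦ by linarith [h P hP Q hQ]) hμ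
  have := le_integral_of_mem_cchull (-f) (c := c - ∫ x, f x ∂(μ : Measure X))
    (fun Q hQ ↦ by simp only [ContinuousMap.neg_apply, integral_neg]; linarith [hST Q hQ]) hν
  simp only [ContinuousMap.neg_apply, integral_neg] at this
  linarith

theorem isCompact_cchull [T2Space X] [BorelSpace X] (S : Set (ProbabilityMeasure X)) :
    IsCompact (cchull S) := by
  refine (isCompact_setOfPred_finiteMeasure_eq_of_compactSpace X 1).of_isClosed_subset
    isClosed_closure (cchull_subset ?_ (isClosed_eq (by fun_prop) (by fun_prop)) (by simp))
  intro μ hμ ν hν a b _ _ hab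
  have hsmul (c : ℝ≥0) (ρ : FiniteMeasure X) : (c • ρ).mass = c * ρ.mass := by
    simp [FiniteMeasure.mass]
  have hadd (ρ σ : FiniteMeasure X) : (ρ + σ).mass = ρ.mass + σ.mass := by
    simp [FiniteMeasure.mass]
  simp only [Set.mem_ofPred_eq] at hμ hν ⊢
  rw [hadd, hsmul, hsmul, hμ, hν, mul_one, mul_one, hab]

/-- The differences of elements of the closed convex hulls, as functionals on `C(X, ℝ)`. -/
def hullDifferences (S T : Set (ProbabilityMeasure X)) : Set (C(X, ℝ) → ℝ) :=
  (fun p : FiniteMeasure X × FiniteMeasure X ↦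
    fun f : C(X, ℝ) ↦ ∫ x, f x ∂(p.1 : Measure X) - ∫ x, f x ∂(p.2 : Measure X)) ''
    (cchull S ×ˢ cchull T)

theorem isCompact_hullDifferences [T2Space X] [BorelSpace X] (S T : Set (ProbabilityMeasure X)) :
    IsCompact (hullDifferences S T) :=
  ((isCompact_cchull S).prod (isCompact_cchull T)).image <| continuous_pi fun f ↦
    ((FiniteMeasure.continuous_integral_continuousMap f).comp continuous_fst).sub
      ((FiniteMeasure.continuous_integral_continuousMap f).comp continuous_snd)

theorem convex_hullDifferences (S T : Set (ProbabilityMeasure X)) :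
    Convex ℝ (hullDifferences S T) := by
  rintro _ ⟨p, hp, rfl⟩ _ ⟨q, hq, rfl⟩ a b ha hb hab
  lift a to ℝ≥0 using ha
  lift b to ℝ≥0 using hb
  have hab' : a + b = 1 := by exact_mod_cast hab
  refine ⟨a • p + b • q, ⟨convex_cchull_combination hp.1 hq.1 hab',
    convex_cchull_combination hp.2 hq.2 hab'⟩, ?_⟩
  funext f
  simp only [Prod.fst_add, Prod.snd_add, Prod.smul_fst, Prod.smul_snd, integral_smul_add_smul,
    Pi.add_apply, Pi.smul_apply, smul_eq_mul]
  ring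

/-- A uniform choice of test function for all pairs in the closed convex hulls, by Sion's minimax
theorem. -/
theorem exists_forall_mem_hullDifferences_lt [T2Space X] [BorelSpace X]
    {S T : Set (ProbabilityMeasure X)}
    (hS : S.Nonempty) (hT : T.Nonempty) {t : ℝ}
    (h : ∀ u ∈ hullDifferences S T, ∃ f : C(X, ℝ), ‖f‖ ≤ 1 ∧ t < u f) :
    ∃ f : C(X, ℝ), ‖f‖ ≤ 1 ∧ ∀ u ∈ hullDifferences S T, t < u f := by
  have hK := isCompact_hullDifferences S T
  have hne : (hullDifferences S T).Nonempty := by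
    obtain ⟨P, hP⟩ := hS
    obtain ⟨Q, hQ⟩ := hT
    exact ⟨_, (_, _), ⟨toFiniteMeasure_mem_cchull hP, toFiniteMeasure_mem_cchull hQ⟩, rfl⟩
  have hcont (f : C(X, ℝ)) : Continuous fun u : C(X, ℝ) → ℝ ↦ u f := continuous_apply f
  have hmem (f : C(X, ℝ)) : f ∈ Metric.closedBall (0 : C(X, ℝ)) 1 ↔ ‖f‖ ≤ 1 := by simp
  simp only [← hmem] at h ⊢
  obtain ⟨s, hs, hsf, hcover⟩ := hK.elim_finite_subcover_image
    (b := Metric.closedBall (0 : C(X, ℝ)) 1) (c := fun f ↦ {u | t < u f})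
    (fun f _ ↦ (isOpen_lt continuous_const (hcont f) : IsOpen {u : C(X, ℝ) → ℝ | t < u f}))
    (fun u hu ↦ by simpa using h u hu)
  refine Sion.exists_lt_iInf_of_lt_iInf_of_finite (f := fun (u : C(X, ℝ) → ℝ) f ↦ u f) hne hK
    (fun f _ ↦ (hcont f).lowerSemicontinuous.lowerSemicontinuousOn _)
    (fun f _ ↦ ((LinearMap.proj f : (C(X, ℝ) → ℝ) →ₗ[ℝ] ℝ).convexOn
      (convex_hullDifferences S T)).quasiconvexOn)
    (convex_closedBall _ _) ?_ ?_ (convex_hullDifferences S T) hsf hs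
    (fun u hu ↦ by simpa using hcover hu)
  · rintro _ ⟨p, -, rfl⟩
    exact (ContinuousMap.integralCLM (p.1 : Measure X) -
      ContinuousMap.integralCLM (p.2 : Measure X)).continuous.upperSemicontinuous
        |>.upperSemicontinuousOn _
  · rintro _ ⟨p, -, rfl⟩
    exact ((ContinuousMap.integralCLM (p.1 : Measure X) -
      ContinuousMap.integralCLM (p.2 : Measure X)).toLinearMap.concaveOn
        (convex_closedBall _ _)).quasiconcaveOn

end Hull

theorem stmt2 {X : Type*} [MetricSpace X] [CompactSpace X] [MeasurableSpace X] [BorelSpace X]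
    (𝒮 𝒬 : Set (ProbabilityMeasure X)) (h𝒮 : IsCompact 𝒮) (h𝒬 : IsCompact 𝒬)
    (h𝒮ne : 𝒮.Nonempty) (h𝒬ne : 𝒬.Nonempty) :
    IsLeast {d : ℝ | ∃ P ∈ cchull 𝒮, ∃ Q ∈ cchull 𝒬, d = tvDist P Q}
      (sSup {r : ℝ | ∃ f : C(X, ℝ), ‖f‖ ≤ 1 ∧
        r = sInf {s : ℝ | ∃ P ∈ 𝒮, ∃ Q ∈ 𝒬,
          s = ∫ x, f x ∂(P : Measure X) - ∫ x, f x ∂(Q : Measure X)}}) := by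
  have hbdd (f : C(X, ℝ)) : BddBelow {s : ℝ | ∃ P ∈ 𝒮, ∃ Q ∈ 𝒬,
      s = ∫ x, f x ∂(P : Measure X) - ∫ x, f x ∂(Q : Measure X)} := by
    obtain ⟨c, hc⟩ := ((isCompact_univ (X := ProbabilityMeasure X × ProbabilityMeasure X)).image
      (((ProbabilityMeasure.continuous_integral_continuousMap f).comp continuous_fst).sub
        ((ProbabilityMeasure.continuous_integral_continuousMap f).comp continuous_snd))).bddBelow
    refine ⟨c, ?_⟩
    rintro _ ⟨P, -, Q, -, rfl⟩
    exact hc ⟨(P, Q), trivial, rfl⟩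
  have hweak {f : C(X, ℝ)} (hf : ‖f‖ ≤ 1) {P Q : FiniteMeasure X} (hP : P ∈ cchull 𝒮)
      (hQ : Q ∈ cchull 𝒬) : sInf {s : ℝ | ∃ P ∈ 𝒮, ∃ Q ∈ 𝒬,
        s = ∫ x, f x ∂(P : Measure X) - ∫ x, f x ∂(Q : Measure X)} ≤ tvDist P Q :=
    (le_integral_sub_integral_of_mem_cchull f
      (fun P hP Q hQ ↦ csInf_le (hbdd f) ⟨P, hP, Q, hQ, rfl⟩) hP hQ).trans
      (integral_sub_integral_le_tvDist P Q f hf)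
  obtain ⟨P₀, hP₀⟩ := h𝒮ne
  obtain ⟨Q₀, hQ₀⟩ := h𝒬ne
  set V := sSup {r : ℝ | ∃ f : C(X, ℝ), ‖f‖ ≤ 1 ∧
    r = sInf {s : ℝ | ∃ P ∈ 𝒮, ∃ Q ∈ 𝒬,
      s = ∫ x, f x ∂(P : Measure X) - ∫ x, f x ∂(Q : Measure X)}} with hV
  have hlower {P Q : FiniteMeasure X} (hP : P ∈ cchull 𝒮) (hQ : Q ∈ cchull 𝒬) :
      V ≤ tvDist P Q := by
    refine csSup_le ⟨_, 0, by simp, rfl⟩ ?_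
    rintro _ ⟨f, hf, rfl⟩
    exact hweak hf hP hQ
  refine ⟨?_, ?_⟩
  · by_contra hV'
    have hlt {P Q : FiniteMeasure X} (hP : P ∈ cchull 𝒮) (hQ : Q ∈ cchull 𝒬) :
        V < tvDist P Q :=
      (hlower hP hQ).lt_of_ne fun h ↦ hV' ⟨P, hP, Q, hQ, h⟩
    obtain ⟨f, hf, hfV⟩ := exists_forall_mem_hullDifferences_lt ⟨P₀, hP₀⟩ ⟨Q₀, hQ₀⟩ (t := V) (by
      rintro _ ⟨⟨P, Q⟩, ⟨hP, hQ⟩, rfl⟩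
      exact exists_lt_integral_sub_integral_of_lt_tvDist P Q (hlt hP hQ))
    have hmem {P Q : ProbabilityMeasure X} (hP : P ∈ 𝒮) (hQ : Q ∈ 𝒬) :
        (fun f : C(X, ℝ) ↦ ∫ x, f x ∂(P : Measure X) - ∫ x, f x ∂(Q : Measure X)) ∈
          hullDifferences 𝒮 𝒬 :=
      ⟨(P.toFiniteMeasure, Q.toFiniteMeasure),
        ⟨toFiniteMeasure_mem_cchull hP, toFiniteMeasure_mem_cchull hQ⟩, rfl⟩
    obtain ⟨u, hu, hmin⟩ := (isCompact_hullDifferences 𝒮 𝒬).exists_isMinOn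
      ⟨_, hmem hP₀ hQ₀⟩ (continuous_apply f).continuousOn
    refine ((hfV u hu).trans_le (?_ : u f ≤ V)).false
    refine le_csSup_of_le ⟨tvDist P₀.toFiniteMeasure Q₀.toFiniteMeasure, ?_⟩ ⟨f, hf, rfl⟩
      (le_csInf ⟨_, P₀, hP₀, Q₀, hQ₀, rfl⟩ ?_)
    · rintro _ ⟨g, hg, rfl⟩
      exact hweak hg (toFiniteMeasure_mem_cchull hP₀) (toFiniteMeasure_mem_cchull hQ₀)
    · rintro _ ⟨P, hP, Q, hQ, rfl⟩
      exact hmin (hmem hP hQ)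
  · rintro _ ⟨P, hP, Q, hQ, rfl⟩
    exact hlower hP hQ

end
end

section
/- Let X be a compact metric space, P a Borel probability measure on X, Q a nonempty weak*-compact subset of Δ(X), and ε > 0. The following are equivalent: (a) there exist a countably additive Borel signed measure e on X with total variation ‖e‖₁ ≤ ε and a Borel probability measure m on Q such that P = Q_m + e, where Q_m(E) = ∫_Q Q(E) dm(Q) for all Borel E; (b) for all continuous f : X → ℝ with ‖f‖_∞ = 1, ∫_X f dP ≤ (max over Q ∈ Q of ∫_X f dQ) + ε; (c) for all continuous f : X → ℝ with ‖f‖_∞ = 1, ∫_X f dP ≥ (min over Q ∈ Q of ∫_X f dQ) − ε. -/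
open MeasureTheory
open scoped NNReal

noncomputable section

noncomputable instance {X : Type*} [MeasurableSpace X] [TopologicalSpace X] [OpensMeasurableSpace X] :
    MeasurableSpace (ProbabilityMeasure X) := borel _

/-- Total variation norm of a signed measure. -/
def tvNorm {X : Type*} [MeasurableSpace X] (e : SignedMeasure X) : ℝ :=
  (e.totalVariation Set.univ).toReal

/-- `Qm` is the barycenter of `m : Δ(𝒬)`: `Qm E = ∫_𝒬 Q(E) dm(Q)` for every Borel `E`. -/
def IsBarycenter {X : Type*} [MeasurableSpace X] [TopologicalSpace X] [OpensMeasurableSpace X]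
    (𝒬 : Set (ProbabilityMeasure X)) (m : Measure ↥𝒬) (Qm : ProbabilityMeasure X) : Prop :=
  ∀ E : Set X, MeasurableSet E →
    (Qm E : ℝ) = ∫ Q, ((Q : ProbabilityMeasure X) E : ℝ) ∂m

instance {X : Type*} [MeasurableSpace X] [TopologicalSpace X] [OpensMeasurableSpace X] :
    BorelSpace (ProbabilityMeasure X) := ⟨rfl⟩

open Filter Topology BoundedContinuousFunction CompactlySupported

section Barycenter

variable {X : Type*} [MeasurableSpace X] [TopologicalSpace X] [HasOuterApproxClosed X]
  [BorelSpace X]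

/-- The inclusion of `Δ(X)`, with the Borel sets of the weak topology, into the Giry space of
measures is measurable. -/
lemma measurable_probabilityMeasure_toMeasure :
    Measurable (fun Q : ProbabilityMeasure X => (Q : Measure X)) := by
  refine Measurable.measure_of_isPiSystem_of_isProbabilityMeasure
    (S := {F | IsClosed F})
    (by rw [BorelSpace.measurable_eq (α := X), borel_eq_generateFrom_isClosed])
    isPiSystem_isClosed fun F (hF : IsClosed F) => ?_
  refine measurable_of_tendsto_metrizable
    (f := fun n (Q : ProbabilityMeasure X) => ∫⁻ x, hF.apprSeq n x ∂(Q : Measure X))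
    (fun n => ?_) (tendsto_pi_nhds.2 fun Q =>
      HasOuterApproxClosed.tendsto_lintegral_apprSeq hF (Q : Measure X))
  exact (ProbabilityMeasure.continuous_lintegral_boundedContinuousFunction (hF.apprSeq n)).measurable

variable {𝒬 : Set (ProbabilityMeasure X)} {m : Measure ↥𝒬}

lemma measurable_subtype_toMeasure :
    Measurable (fun Q : ↥𝒬 => ((Q : ProbabilityMeasure X) : Measure X)) :=
  measurable_probabilityMeasure_toMeasure.comp measurable_subtype_coe

lemma integral_apply_eq_bind (E : Set X) (hE : MeasurableSet E) :
    ∫ Q, ((Q : ProbabilityMeasure X) E : ℝ) ∂m =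
      (m.bind fun Q : ↥𝒬 => ((Q : ProbabilityMeasure X) : Measure X)).real E := by
  have hmeas := Measure.measurable_measure.1 (measurable_subtype_toMeasure (𝒬 := 𝒬)) E hE
  rw [measureReal_def, Measure.bind_apply hE measurable_subtype_toMeasure.aemeasurable]
  exact integral_toReal hmeas.aemeasurable (ae_of_all _ fun Q => measure_lt_top _ _)

variable [IsProbabilityMeasure m]

instance isProbabilityMeasure_bind_subtype :
    IsProbabilityMeasure (m.bind fun Q : ↥𝒬 => ((Q : ProbabilityMeasure X) : Measure X)) :=
  ⟨by simp [Measure.bind_apply .univ measurable_subtype_toMeasure.aemeasurable]⟩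

lemma isBarycenter_iff {Qm : ProbabilityMeasure X} :
    IsBarycenter 𝒬 m Qm ↔
      (Qm : Measure X) = m.bind fun Q : ↥𝒬 => ((Q : ProbabilityMeasure X) : Measure X) := by
  refine ⟨fun h => ?_, fun h E hE => ?_⟩
  · ext E hE
    rw [← measureReal_eq_measureReal_iff, ← integral_apply_eq_bind E hE, ← h E hE]
    rfl
  · rw [integral_apply_eq_bind E hE, ← h]
    rfl

lemma IsBarycenter.integral_eq {Qm : ProbabilityMeasure X} (h : IsBarycenter 𝒬 m Qm)
    (f : X →ᵇ ℝ) :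
    ∫ x, f x ∂(Qm : Measure X) =
      ∫ Q : ↥𝒬, ∫ x, f x ∂((Q : ProbabilityMeasure X) : Measure X) ∂m := by
  let κ : ProbabilityTheory.Kernel ↥𝒬 X := ⟨_, measurable_subtype_toMeasure⟩
  have hκ : (κ.comp (ProbabilityTheory.Kernel.const Unit m)) () = (Qm : Measure X) :=
    (isBarycenter_iff.1 h).symm
  rw [← hκ]
  exact ProbabilityTheory.Kernel.integral_comp (η := κ)
    (κ := ProbabilityTheory.Kernel.const Unit m) (a := ()) (by rw [hκ]; exact f.integrable _)

end Barycenter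

section TotalVariation

variable {X : Type*} [MeasurableSpace X]

/-- A relation `μ = ν + e` of signed measures, written without subtraction. -/
lemma add_negPart_eq_add_posPart {μ ν : Measure X} [IsFiniteMeasure μ] [IsFiniteMeasure ν]
    {e : SignedMeasure X} (h : μ.toSignedMeasure = ν.toSignedMeasure + e) :
    μ + e.toJordanDecomposition.negPart = ν + e.toJordanDecomposition.posPart := by
  rw [← Measure.toSignedMeasure_eq_toSignedMeasure_iff, Measure.toSignedMeasure_add,
    Measure.toSignedMeasure_add, h]
  nth_rw 1 [← e.toSignedMeasure_toJordanDecomposition]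
  rw [JordanDecomposition.toSignedMeasure]
  abel

lemma tvNorm_eq (e : SignedMeasure X) :
    tvNorm e = e.toJordanDecomposition.posPart.real Set.univ +
      e.toJordanDecomposition.negPart.real Set.univ := by
  rw [tvNorm, SignedMeasure.totalVariation, ← measureReal_def, measureReal_add_apply]

lemma integral_sub_integral_eq {μ ν : Measure X} [IsFiniteMeasure μ] [IsFiniteMeasure ν]
    {e : SignedMeasure X} (h : μ.toSignedMeasure = ν.toSignedMeasure + e) {f : X → ℝ}
    (hf : Measurable f) {C : ℝ} (hC : ∀ x, |f x| ≤ C) :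
    ∫ x, f x ∂μ - ∫ x, f x ∂ν =
      ∫ x, f x ∂e.toJordanDecomposition.posPart - ∫ x, f x ∂e.toJordanDecomposition.negPart := by
  have hint (ρ : Measure X) [IsFiniteMeasure ρ] : Integrable f ρ :=
    .of_bound hf.aestronglyMeasurable C (ae_of_all _ hC)
  have key := congrArg (fun ρ => ∫ x, f x ∂ρ) (add_negPart_eq_add_posPart h)
  simp only [integral_add_measure (hint _) (hint _)] at key
  linarith

lemma integral_sub_integral_le_mul_tvNorm {μ ν : Measure X} [IsFiniteMeasure μ]
    [IsFiniteMeasure ν] {e : SignedMeasure X} (h : μ.toSignedMeasure = ν.toSignedMeasure + e)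
    {f : X → ℝ} (hf : Measurable f) {C : ℝ} (hC : ∀ x, |f x| ≤ C) :
    ∫ x, f x ∂μ - ∫ x, f x ∂ν ≤ C * tvNorm e := by
  have hle (ρ : Measure X) [IsFiniteMeasure ρ] : |∫ x, f x ∂ρ| ≤ C * ρ.real Set.univ :=
    norm_integral_le_of_norm_le_const (μ := ρ) (f := f) (ae_of_all _ hC)
  rw [integral_sub_integral_eq h hf hC, tvNorm_eq]
  linarith [(abs_le.1 (hle e.toJordanDecomposition.posPart)).2,
    (abs_le.1 (hle e.toJordanDecomposition.negPart)).1]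

/-- The total variation norm is attained at a sign function. -/
lemma exists_sign_integral_eq_tvNorm {μ ν : Measure X} [IsFiniteMeasure μ]
    [IsFiniteMeasure ν] {e : SignedMeasure X} (h : μ.toSignedMeasure = ν.toSignedMeasure + e) :
    ∃ s : X → ℝ, Measurable s ∧ (∀ x, |s x| ≤ 1) ∧
      tvNorm e = ∫ x, s x ∂μ - ∫ x, s x ∂ν := by
  classical
  obtain ⟨S, hS, -, -, hpos, hneg⟩ := e.toJordanDecomposition.exists_compl_positive_negative
  have hs : Measurable (S.piecewise (fun _ => (-1 : ℝ)) (fun _ => 1)) :=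
    measurable_const.piecewise hS measurable_const
  have hs1 (x : X) : |S.piecewise (fun _ => (-1 : ℝ)) (fun _ => 1) x| ≤ 1 := by
    by_cases hx : x ∈ S <;> simp [hx]
  refine ⟨_, hs, hs1, ?_⟩
  have h1 : ∫ x, S.piecewise (fun _ => (-1 : ℝ)) (fun _ => 1) x
      ∂e.toJordanDecomposition.posPart = e.toJordanDecomposition.posPart.real Set.univ := by
    rw [integral_congr_ae (g := fun _ => (1 : ℝ))]
    · simp
    · filter_upwards [measure_eq_zero_iff_ae_notMem.1 hpos] with x hx
      simp [hx]
  have h2 : ∫ x, S.piecewise (fun _ => (-1 : ℝ)) (fun _ => 1) x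
      ∂e.toJordanDecomposition.negPart = -e.toJordanDecomposition.negPart.real Set.univ := by
    rw [integral_congr_ae (g := fun _ => (-1 : ℝ))]
    · simp
    · filter_upwards [measure_eq_zero_iff_ae_notMem.1 hneg] with x hx
      simp [not_not.1 hx]
  rw [integral_sub_integral_eq h hs hs1, h1, h2, tvNorm_eq]
  ring

lemma abs_sub_max_min_le {s y : ℝ} (hs : |s| ≤ 1) :
    |s - max (-1) (min 1 y)| ≤ |s - y| := by
  rw [abs_le] at hs
  rcases le_total 1 y with h | h <;> rcases le_total (-1) y with h' | h' <;>
    simp [*] <;> grind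

/-- A bound against continuous test functions bounds the total variation norm. -/
lemma tvNorm_le_of_forall_continuous [TopologicalSpace X] [NormalSpace X] [BorelSpace X]
    {μ ν : Measure X} [IsFiniteMeasure μ] [IsFiniteMeasure ν] [(μ + ν).WeaklyRegular]
    {e : SignedMeasure X} (h : μ.toSignedMeasure = ν.toSignedMeasure + e) {ε : ℝ}
    (hle : ∀ f : C(X, ℝ), (∀ x, |f x| ≤ 1) → ∫ x, f x ∂μ - ∫ x, f x ∂ν ≤ ε) :
    tvNorm e ≤ ε := by
  obtain ⟨s, hs, hs1, hse⟩ := exists_sign_integral_eq_tvNorm h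
  refine le_of_forall_pos_le_add fun δ hδ => ?_
  have hsi (ρ : Measure X) [IsFiniteMeasure ρ] : Integrable s ρ :=
    .of_bound hs.aestronglyMeasurable 1 (ae_of_all _ hs1)
  obtain ⟨g, hg, -⟩ := (hsi (μ + ν)).exists_boundedContinuous_integral_sub_le hδ
  let f : C(X, ℝ) := ⟨fun x => max (-1) (min 1 (g x)), by fun_prop⟩
  have hf1 (x : X) : |f x| ≤ 1 := abs_le.2 ⟨le_max_left _ _, max_le (by norm_num) (min_le_left _ _)⟩
  have hfi (ρ : Measure X) [IsFiniteMeasure ρ] : Integrable f ρ :=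
    .of_bound f.continuous.measurable.aestronglyMeasurable 1 (ae_of_all _ hf1)
  have hdi (ρ : Measure X) [IsFiniteMeasure ρ] : Integrable (fun x => |s x - f x|) ρ :=
    ((hsi ρ).sub (hfi ρ)).abs
  have hclose : ∫ x, |s x - f x| ∂μ + ∫ x, |s x - f x| ∂ν ≤ δ := by
    rw [← integral_add_measure (hdi μ) (hdi ν)]
    refine le_trans (integral_mono (hdi _) ((hsi _).sub (g.integrable _)).norm fun x => ?_) hg
    exact abs_sub_max_min_le (hs1 x)
  have habs (ρ : Measure X) [IsFiniteMeasure ρ] :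
      |∫ x, s x ∂ρ - ∫ x, f x ∂ρ| ≤ ∫ x, |s x - f x| ∂ρ := by
    rw [← integral_sub (hsi ρ) (hfi ρ)]
    exact abs_integral_le_integral_abs
  rw [hse]
  linarith [hle f hf1, (abs_le.1 (habs μ)).2, (abs_le.1 (habs ν)).1]

end TotalVariation

section Functionals

lemma exists_isProbabilityMeasure_integral_eq {K : Type*} [TopologicalSpace K] [CompactSpace K]
    [T2Space K] [MeasurableSpace K] [BorelSpace K] (F : C(K, ℝ) →ₗ[ℝ] ℝ)
    (hF : ∀ h, 0 ≤ h → 0 ≤ F h) (hF1 : F 1 = 1) :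
    ∃ m : Measure K, IsProbabilityMeasure m ∧ ∀ h : C(K, ℝ), ∫ x, h x ∂m = F h := by
  let Λ : C_c(K, ℝ) →ₚ[ℝ] ℝ := PositiveLinearMap.mk₀
    { toFun := fun h => F h.toContinuousMap
      map_add' := fun h h' => F.map_add h.toContinuousMap h'.toContinuousMap
      map_smul' := fun c h => F.map_smul c h.toContinuousMap } fun h hh => hF _ hh
  have hint (h : C(K, ℝ)) : ∫ x, h x ∂(RealRMK.rieszMeasure Λ) = F h :=
    RealRMK.integral_rieszMeasure Λ ⟨h, HasCompactSupport.of_compactSpace _⟩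
  refine ⟨RealRMK.rieszMeasure Λ, ⟨?_⟩, hint⟩
  have h1 := hint 1
  simp only [ContinuousMap.one_apply, integral_const, smul_eq_mul, mul_one, hF1] at h1
  rwa [measureReal_def, ENNReal.toReal_eq_one_iff] at h1

/-- Hahn–Banach splitting: a functional dominated by `sup (T f) + ε ‖f‖` is the sum of a
normalized positive functional composed with `T` and a functional of norm at most `ε`. -/
lemma exists_positive_functional_of_le_iSup_add {K E : Type*} [TopologicalSpace K]
    [CompactSpace K] [Nonempty K] [SeminormedAddCommGroup E] [NormedSpace ℝ E]
    (T : E →ₗ[ℝ] C(K, ℝ)) (L : E →ₗ[ℝ] ℝ) {ε : ℝ} (hε : 0 ≤ ε)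
    (hL : ∀ f, L f ≤ (⨆ k, T f k) + ε * ‖f‖) :
    ∃ F : C(K, ℝ) →ₗ[ℝ] ℝ, (∀ h, 0 ≤ h → 0 ≤ F h) ∧ F 1 = 1 ∧
      ∀ f, L f - F (T f) ≤ ε * ‖f‖ := by
  have hbdd (h : C(K, ℝ)) : BddAbove (Set.range h) := (isCompact_range h.continuous).bddAbove
  let φ : LinearMap.range (T.prod (LinearMap.id : E →ₗ[ℝ] E)) →ₗ[ℝ] ℝ :=
    L ∘ₗ LinearMap.snd ℝ C(K, ℝ) E ∘ₗ Submodule.subtype _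
  obtain ⟨G, hGL, hGN⟩ := exists_extension_of_le_sublinear ⟨_, φ⟩
    (fun p : C(K, ℝ) × E => (⨆ k, p.1 k) + ε * ‖p.2‖)
    (fun c hc p => by
      simp only [Prod.smul_fst, ContinuousMap.smul_apply, smul_eq_mul, Prod.smul_snd, norm_smul,
        Real.norm_of_nonneg hc.le, ← Real.mul_iSup_of_nonneg hc.le]
      ring)
    (fun p q => by
      have h1 : (⨆ k, (p + q).1 k) ≤ (⨆ k, p.1 k) + ⨆ k, q.1 k :=
        ciSup_le fun k => add_le_add (le_ciSup (hbdd p.1) k) (le_ciSup (hbdd q.1) k)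
      have h2 := mul_le_mul_of_nonneg_left (norm_add_le p.2 q.2) hε
      simp only [Prod.snd_add]
      linarith)
    (by
      rintro ⟨_, f, rfl⟩
      exact hL f)
  have hG1 (h : C(K, ℝ)) : G (h, 0) ≤ ⨆ k, h k := by simpa using hGN (h, 0)
  have hneg (h : C(K, ℝ)) : G (-h, 0) = -G (h, 0) := by
    rw [← map_neg, Prod.neg_mk, neg_zero]
  refine ⟨G ∘ₗ LinearMap.inl ℝ _ _, fun h hh => ?_, le_antisymm ?_ ?_, fun f => ?_⟩
  · have := (hG1 (-h)).trans (ciSup_le (c := 0) fun k => neg_nonpos.2 (hh k))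
    rw [hneg] at this
    exact neg_nonpos.1 this
  · simpa using hG1 1
  · have := hG1 (-1)
    rw [hneg] at this
    simp only [ContinuousMap.neg_apply, ContinuousMap.one_apply, ciSup_const] at this
    exact neg_le_neg_iff.1 this
  · have h1 : G (T f, f) = L f := hGL ⟨(T f, f), f, rfl⟩
    have h2 : G (0, f) ≤ ε * ‖f‖ := by simpa using hGN (0, f)
    have h3 : G (T f, f) = G (T f, 0) + G (0, f) := by rw [← map_add]; simp
    change L f - G (T f, 0) ≤ _
    linarith

end Functionals

section Evaluation

variable {X : Type*} [TopologicalSpace X] [CompactSpace X] [MeasurableSpace X]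
  [OpensMeasurableSpace X]

/-- The map sending `f` to the function `Q ↦ ∫ f dQ` on `𝒬`. -/
def integralEval (𝒬 : Set (ProbabilityMeasure X)) : C(X, ℝ) →ₗ[ℝ] C(↥𝒬, ℝ) where
  toFun f := ⟨fun Q => ∫ x, f x ∂((Q : ProbabilityMeasure X) : Measure X),
    (ProbabilityMeasure.continuous_integral_continuousMap f).comp continuous_subtype_val⟩
  map_add' f g := by
    ext Q
    exact integral_add ((mkOfCompact f).integrable _) ((mkOfCompact g).integrable _)
  map_smul' c f := by
    ext Q
    exact integral_const_mul c _

lemma sSup_image_eq_iSup_integralEval (𝒬 : Set (ProbabilityMeasure X)) (f : C(X, ℝ)) :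
    sSup ((fun Q : ProbabilityMeasure X => ∫ x, f x ∂(Q : Measure X)) '' 𝒬) =
      ⨆ Q : ↥𝒬, integralEval 𝒬 f Q :=
  sSup_image'

/-- An inequality on the unit sphere extends to all continuous functions by homogeneity. -/
lemma integral_le_iSup_add_mul_norm {P : ProbabilityMeasure X} {𝒬 : Set (ProbabilityMeasure X)}
    {ε : ℝ} (h : ∀ f : C(X, ℝ), ‖f‖ = 1 →
      ∫ x, f x ∂(P : Measure X) ≤ (⨆ Q : ↥𝒬, integralEval 𝒬 f Q) + ε) (f : C(X, ℝ)) :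
    ∫ x, f x ∂(P : Measure X) ≤ (⨆ Q : ↥𝒬, integralEval 𝒬 f Q) + ε * ‖f‖ := by
  rcases eq_or_ne f 0 with rfl | hf
  · simp
  have hpos : 0 < ‖f‖ := norm_pos_iff.2 hf
  have key := h (‖f‖⁻¹ • f) (norm_smul_inv_norm hf)
  simp only [map_smul, ContinuousMap.smul_apply, smul_eq_mul, integral_const_mul,
    ← Real.mul_iSup_of_nonneg (inv_nonneg.2 hpos.le)] at key
  have := mul_le_mul_of_nonneg_left key hpos.le
  rwa [mul_add, mul_inv_cancel_left₀ hpos.ne', mul_inv_cancel_left₀ hpos.ne', mul_comm ‖f‖ ε]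
    at this

end Evaluation

lemma sSup_image_integral_neg {X : Type*} [TopologicalSpace X] [MeasurableSpace X]
    (𝒬 : Set (ProbabilityMeasure X)) (f : C(X, ℝ)) :
    sSup ((fun Q : ProbabilityMeasure X => ∫ x, (-f) x ∂(Q : Measure X)) '' 𝒬) =
      -sInf ((fun Q : ProbabilityMeasure X => ∫ x, f x ∂(Q : Measure X)) '' 𝒬) := by
  rw [Real.sInf_def, neg_neg, ← Set.image_neg_eq_neg, Set.image_image]
  simp [integral_neg]

theorem stmt6 {X : Type*} [MetricSpace X] [CompactSpace X] [MeasurableSpace X] [BorelSpace X]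
    (P : ProbabilityMeasure X)
    (𝒬 : Set (ProbabilityMeasure X)) (h𝒬 : IsCompact 𝒬) (h𝒬ne : 𝒬.Nonempty)
    (ε : ℝ) (hε : 0 < ε) :
    ((∃ (e : SignedMeasure X) (m : Measure ↥𝒬) (_ : IsProbabilityMeasure m)
        (Qm : ProbabilityMeasure X), IsBarycenter 𝒬 m Qm ∧ tvNorm e ≤ ε ∧
          P.toMeasure.toSignedMeasure = Qm.toMeasure.toSignedMeasure + e) ↔
      (∀ f : C(X, ℝ), ‖f‖ = 1 →
        ∫ x, f x ∂(P : Measure X) ≤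
          sSup ((fun Q : ProbabilityMeasure X => ∫ x, f x ∂(Q : Measure X)) '' 𝒬) + ε)) ∧
    ((∀ f : C(X, ℝ), ‖f‖ = 1 →
        ∫ x, f x ∂(P : Measure X) ≤
          sSup ((fun Q : ProbabilityMeasure X => ∫ x, f x ∂(Q : Measure X)) '' 𝒬) + ε) ↔
      (∀ f : C(X, ℝ), ‖f‖ = 1 →
        ∫ x, f x ∂(P : Measure X) ≥
          sInf ((fun Q : ProbabilityMeasure X => ∫ x, f x ∂(Q : Measure X)) '' 𝒬) - ε)) := by
  have : CompactSpace ↥𝒬 := isCompact_iff_compactSpace.1 h𝒬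
  have : Nonempty ↥𝒬 := h𝒬ne.to_subtype
  refine ⟨⟨?_, fun h => ?_⟩, ⟨fun h f hf => ?_, fun h f hf => ?_⟩⟩
  · rintro ⟨e, m, _, Qm, hm, he, hP⟩ f hf
    have h1 : ∫ x, f x ∂(P : Measure X) - ∫ x, f x ∂(Qm : Measure X) ≤ 1 * tvNorm e :=
      integral_sub_integral_le_mul_tvNorm hP f.continuous.measurable
        fun x => (f.norm_coe_le_norm x).trans_eq hf
    have h2 : ∫ x, f x ∂(Qm : Measure X) ≤ ⨆ Q : ↥𝒬, integralEval 𝒬 f Q :=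
      calc ∫ x, f x ∂(Qm : Measure X) = ∫ Q, integralEval 𝒬 f Q ∂m :=
            hm.integral_eq (mkOfCompact f)
        _ ≤ ∫ _, (⨆ Q : ↥𝒬, integralEval 𝒬 f Q) ∂m :=
            integral_mono ((mkOfCompact (integralEval 𝒬 f)).integrable _) (integrable_const _)
              fun Q => le_ciSup (isCompact_range (integralEval 𝒬 f).continuous).bddAbove Q
        _ = _ := by simp
    rw [sSup_image_eq_iSup_integralEval]
    linarith
  · simp only [sSup_image_eq_iSup_integralEval] at h
    obtain ⟨F, hF, hF1, hFL⟩ := exists_positive_functional_of_le_iSup_add (integralEval 𝒬)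
      { toFun := fun f : C(X, ℝ) => ∫ x, f x ∂(P : Measure X)
        map_add' := fun f g =>
          integral_add ((mkOfCompact f).integrable _) ((mkOfCompact g).integrable _)
        map_smul' := fun c f => integral_const_mul c _ }
      hε.le (integral_le_iSup_add_mul_norm h)
    obtain ⟨m, _, hm⟩ := exists_isProbabilityMeasure_integral_eq F hF hF1
    let Qm : ProbabilityMeasure X := ⟨m.bind fun Q : ↥𝒬 => ((Q : ProbabilityMeasure X) : Measure X),
      isProbabilityMeasure_bind_subtype⟩
    have hQm : IsBarycenter 𝒬 m Qm := isBarycenter_iff.2 rfl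
    have hP : P.toMeasure.toSignedMeasure = Qm.toMeasure.toSignedMeasure +
        (P.toMeasure.toSignedMeasure - Qm.toMeasure.toSignedMeasure) := by abel
    refine ⟨_, m, inferInstance, Qm, hQm, tvNorm_le_of_forall_continuous hP fun f hf => ?_, hP⟩
    have hint : ∫ x, f x ∂(Qm : Measure X) = F (integralEval 𝒬 f) :=
      (hQm.integral_eq (mkOfCompact f)).trans (hm (integralEval 𝒬 f))
    rw [hint]
    exact (hFL f).trans (mul_le_of_le_one_right hε.le ((ContinuousMap.norm_le _ zero_le_one).2 hf))
  · have := h (-f) (by rwa [norm_neg])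
    rw [sSup_image_integral_neg] at this
    simp only [ContinuousMap.neg_apply, integral_neg] at this
    linarith
  · have := h (-f) (by rwa [norm_neg])
    rw [← neg_neg f, sSup_image_integral_neg]
    simp only [ContinuousMap.neg_apply, integral_neg] at this ⊢
    linarith

end
end

section
/- Let Y be a finite set, D the family of all nonempty subsets of Y, X = {(y, B) : B ∈ D, y ∈ B}, and L the set of all strict linear orders on Y. Let P₀ be a stochastic choice function and, for each ≻ ∈ L, let a_≻ : X → {0,1} be given by a_≻(y, B) = 1 if no y′ ∈ B satisfies y′ ≻ y, and 0 otherwise. Let ε ≥ 0. Then P₀ satisfies ε-ARSP (for every function t : X → ℕ, Σ_{(y,B) ∈ X} P₀(y, B)·t(y, B) ≤ max_{≻ ∈ L} Σ_{(y,B) ∈ X} a_≻(y, B)·t(y, B) + (max t − min t)·ε/2) if, and only if, there exist a function e : X → ℝ with Σ_{(y,B) ∈ X} |e(y, B)| ≤ ε and a probability distribution π on L such that P₀(y, B) = Σ_{≻ ∈ L : a_≻(y,B) = 1} π(≻) + e(y, B) for all (y, B) ∈ X. -/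
noncomputable section

/-- The type of strict linear orders (irreflexive, transitive, total relations) on `Y`. -/
abbrev SLO (Y : Type*) := {r : Y → Y → Prop // IsStrictTotalOrder Y r}

noncomputable instance {Y : Type*} [Finite Y] : Fintype (SLO Y) := Fintype.ofFinite _

instance {Y : Type*} : Nonempty (SLO Y) := ⟨⟨WellOrderingRel, inferInstance⟩⟩

open Classical in
/-- `a_≻(y,B) = 1` if no `y' ∈ B` satisfies `y' ≻ y`, and `0` otherwise. -/
def aFn {Y : Type*} (r : Y → Y → Prop) (y : Y) (B : Finset Y) : ℝ :=
  if ∀ y' ∈ B, ¬ r y' y then 1 else 0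

/-- The set `X` of pairs `(y, B)` with `B` a nonempty subset of `Y` and `y ∈ B`. -/
def allPairs (Y : Type*) [Fintype Y] [DecidableEq Y] : Finset (Y × Finset Y) :=
  Finset.univ.filter fun p => p.1 ∈ p.2

theorem allPairs_nonempty {Y : Type*} [Fintype Y] [DecidableEq Y] [Nonempty Y] :
    (allPairs Y).Nonempty := by
  obtain ⟨y⟩ := ‹Nonempty Y›
  exact ⟨(y, {y}), by simp [allPairs]⟩

/-- Maximum value of `t` over the pairs `(y, B)` with `y ∈ B`. -/
def maxT {Y : Type*} [Fintype Y] [DecidableEq Y] [Nonempty Y] (t : Y → Finset Y → ℕ) : ℕ :=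
  (allPairs Y).sup' allPairs_nonempty fun p => t p.1 p.2

/-- Minimum value of `t` over the pairs `(y, B)` with `y ∈ B`. -/
def minT {Y : Type*} [Fintype Y] [DecidableEq Y] [Nonempty Y] (t : Y → Finset Y → ℕ) : ℕ :=
  (allPairs Y).inf' allPairs_nonempty fun p => t p.1 p.2

/-- A stochastic choice function on a finite set `Y`. -/
def IsSCF {Y : Type*} [Fintype Y] [DecidableEq Y] (P₀ : Y → Finset Y → ℝ) : Prop :=
  ∀ B : Finset Y, B.Nonempty → (∀ y ∈ B, 0 ≤ P₀ y B) ∧ (∑ y ∈ B, P₀ y B) = 1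

open scoped Pointwise in
/-- If every functional `u` in the unit sup-norm ball satisfies `⟨p, u⟩ ≤ ⟨A r, u⟩ + ε` for some
`r`, then `p` is within `ℓ¹`-distance `ε` of a convex combination of the points `A r`. -/
theorem exists_convex_combination_add_small {ι κ : Type*} [Fintype ι] [Fintype κ]
    (A : κ → ι → ℝ) (p : ι → ℝ) {ε : ℝ} (hε : 0 ≤ ε)
    (h : ∀ u : ι → ℝ, (∀ i, |u i| ≤ 1) → ∃ r, ∑ i, p i * u i ≤ ∑ i, A r i * u i + ε) :
    ∃ π : κ → ℝ, ∃ e : ι → ℝ, (∀ r, 0 ≤ π r) ∧ ∑ r, π r = 1 ∧ ∑ i, |e i| ≤ ε ∧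
      ∀ i, p i = ∑ r, π r * A r i + e i := by
  classical
  let T : (κ → ℝ) →ₗ[ℝ] (ι → ℝ) := Fintype.linearCombination ℝ A
  have hT : ∀ π i, T π i = ∑ r, π r * A r i := by
    intro π i
    simp [T, Fintype.linearCombination_apply]
  let K : Set (ι → ℝ) := T '' stdSimplex ℝ κ
  let E : Set (ι → ℝ) := {e | ∑ i, |e i| ≤ ε}
  have hK : IsCompact K := (isCompact_stdSimplex ℝ κ).image T.continuous_of_finiteDimensional
  have hKc : Convex ℝ K := (convex_stdSimplex ℝ κ).linear_image T
  have hE : IsClosed E := isClosed_le (by fun_prop) continuous_const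
  have hEc : Convex ℝ E := by
    intro x hx y hy a b ha hb hab
    simp only [E, Set.mem_ofPred_eq] at hx hy ⊢
    calc ∑ i, |(a • x + b • y) i| ≤ ∑ i, (a * |x i| + b * |y i|) := by
          refine Finset.sum_le_sum fun i _ => ?_
          simpa [abs_mul, abs_of_nonneg ha, abs_of_nonneg hb] using abs_add_le (a * x i) (b * y i)
      _ = a * ∑ i, |x i| + b * ∑ i, |y i| := by
          rw [Finset.sum_add_distrib, Finset.mul_sum, Finset.mul_sum]
      _ ≤ a * ε + b * ε := by gcongr
      _ = ε := by rw [← add_mul, hab, one_mul]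
  by_cases hp : p ∈ K + E
  · obtain ⟨_, ⟨π, hπ, rfl⟩, e, he, rfl⟩ := hp
    exact ⟨π, e, hπ.1, hπ.2, he, fun i => by simp [hT]⟩
  exfalso
  obtain ⟨f, s, hf, hs⟩ := geometric_hahn_banach_closed_point (hKc.add hEc)
    (hE.add_left_of_isCompact hK) hp
  set u : ι → ℝ := fun i => f (Pi.single i 1) with hu
  have hfu : ∀ x, f x = ∑ i, x i * u i := by
    intro x
    conv_lhs => rw [← Finset.univ_sum_single x, map_sum]
    refine Finset.sum_congr rfl fun i _ => ?_
    rw [hu, ← smul_eq_mul (x i), ← map_smul, ← Pi.single_smul, smul_eq_mul, mul_one]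
  have hA : ∀ r, A r ∈ K := fun r => ⟨Pi.single r 1, single_mem_stdSimplex ℝ r, by
    ext i; simp [hT, Pi.single_apply]⟩
  have hsep : ∀ r, ∀ e ∈ E, f (A r) + f e < f p := fun r e he => by
    rw [← map_add]
    exact (hf _ (Set.add_mem_add (hA r) he)).trans hs
  obtain ⟨r₀, -⟩ := h 0 (by simp)
  have h0 : (0 : ι → ℝ) ∈ E := by simpa [E] using hε
  have hne : ∃ i, u i ≠ 0 := by
    by_contra! hz
    have := hsep r₀ 0 h0
    simp [hfu, hz] at this
  obtain ⟨j, hj⟩ := hne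
  have : Nonempty ι := ⟨j⟩
  obtain ⟨m, hm⟩ := Finite.exists_max fun i => |u i|
  have hM : 0 < |u m| := (abs_pos.mpr hj).trans_le (hm j)
  obtain ⟨r, hr⟩ := h (fun i => u i / |u m|) fun i => by
    rw [abs_div, abs_abs]
    exact div_le_one_of_le₀ (hm i) hM.le
  simp only [← mul_div_assoc, ← Finset.sum_div] at hr
  rw [← hfu, ← hfu, div_add' _ _ _ hM.ne', div_le_div_iff_of_pos_right hM] at hr
  have he : Pi.single m (ε * SignType.sign (u m) : ℝ) ∈ E := by
    have hsign : |((SignType.sign (u m) : SignType) : ℝ)| ≤ 1 := by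
      rcases lt_trichotomy (u m) 0 with h | h | h <;> simp [h]
    simp only [E, Set.mem_ofPred_eq, Pi.single_apply, apply_ite abs, abs_zero,
      Finset.sum_ite_eq', Finset.mem_univ, if_true, abs_mul, abs_of_nonneg hε]
    exact mul_le_of_le_one_right hε hsign
  have := hsep r _ he
  rw [hfu (Pi.single m _)] at this
  simp only [Pi.single_apply, ite_mul, zero_mul, Finset.sum_ite_eq',
    Finset.mem_univ, if_true, mul_assoc, sign_mul_self] at this
  linarith

/-- Version of `exists_convex_combination_add_small` for coordinates in a finset. -/
theorem exists_convex_combination_add_small_on {ι κ : Type*} [Fintype ι] [Fintype κ]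
    (s : Finset ι) (A : κ → ι → ℝ) (p : ι → ℝ) {ε : ℝ} (hε : 0 ≤ ε)
    (h : ∀ u : ι → ℝ, (∀ i, |u i| ≤ 1) → ∃ r, ∑ i ∈ s, p i * u i ≤ ∑ i ∈ s, A r i * u i + ε) :
    ∃ π : κ → ℝ, ∃ e : ι → ℝ, (∀ r, 0 ≤ π r) ∧ ∑ r, π r = 1 ∧ ∑ i ∈ s, |e i| ≤ ε ∧
      ∀ i ∈ s, p i = ∑ r, π r * A r i + e i := by
  classical
  obtain ⟨π, e, hπ, hπ1, he, hp⟩ := exists_convex_combination_add_small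
    (fun r i => if i ∈ s then A r i else 0) (fun i => if i ∈ s then p i else 0) hε
    (by simpa [ite_mul, Finset.sum_ite_mem] using h)
  refine ⟨π, e, hπ, hπ1,
    (Finset.sum_le_univ_sum_of_nonneg fun i => abs_nonneg (e i)).trans he, fun i hi => ?_⟩
  simpa [hi] using hp i

theorem sum_allPairs {Y : Type*} [Fintype Y] [DecidableEq Y] (F : Y → Finset Y → ℝ) :
    ∑ p ∈ allPairs Y, F p.1 p.2 = ∑ B : Finset Y, ∑ y ∈ B, F y B := by
  rw [allPairs, Finset.sum_filter, Fintype.sum_prod_type_right]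
  simp [Finset.sum_ite_mem]

theorem aFn_nonneg {Y : Type*} (r : Y → Y → Prop) (y : Y) (B : Finset Y) : 0 ≤ aFn r y B := by
  unfold aFn
  split_ifs <;> norm_num

theorem sum_aFn {Y : Type*} (r : SLO Y) {B : Finset Y} (hB : B.Nonempty) :
    ∑ y ∈ B, aFn r.1 y B = 1 := by
  classical
  obtain ⟨r, hr⟩ := r
  have : WellFounded fun a b : B => r a b :=
    @Finite.wellFounded_of_trans_of_irrefl B _ (fun a b => r a b)
      ⟨fun _ _ _ h h' => hr.trans _ _ _ h h'⟩ ⟨fun a => hr.irrefl a⟩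
  obtain ⟨⟨m, hm⟩, -, hmax⟩ := this.has_min Set.univ ⟨⟨_, hB.choose_spec⟩, Set.mem_univ _⟩
  have hmB : ∀ y ∈ B, ¬ r y m := fun y hy => hmax ⟨y, hy⟩ (Set.mem_univ _)
  rw [Finset.sum_eq_single_of_mem m hm, aFn, if_pos hmB]
  intro y hy hne
  rw [aFn, if_neg fun hyB => hne (hr.trichotomous _ _ (hmB y hy) (hyB m hm))]

/-- The choice probabilities of any two stochastic choice functions have the same total mass. -/
theorem sum_allPairs_aFn {Y : Type*} [Fintype Y] [DecidableEq Y] {P₀ : Y → Finset Y → ℝ}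
    (hSCF : IsSCF P₀) (r : SLO Y) :
    ∑ p ∈ allPairs Y, aFn r.1 p.1 p.2 = ∑ p ∈ allPairs Y, P₀ p.1 p.2 := by
  rw [sum_allPairs, sum_allPairs]
  refine Finset.sum_congr rfl fun B _ => ?_
  obtain rfl | hB := B.eq_empty_or_nonempty
  · simp
  · rw [sum_aFn r hB, (hSCF B hB).2]

theorem exists_pairing_le_of_arsp {Y : Type*} [Fintype Y] [DecidableEq Y] [Nonempty Y]
    {P₀ : Y → Finset Y → ℝ} (hSCF : IsSCF P₀) {ε : ℝ} (hε : 0 ≤ ε)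
    (h : ∀ t : Y → Finset Y → ℕ,
      (∑ p ∈ allPairs Y, P₀ p.1 p.2 * t p.1 p.2) ≤
        (⨆ r : SLO Y, ∑ p ∈ allPairs Y, aFn r.1 p.1 p.2 * t p.1 p.2)
          + ((maxT t : ℝ) - (minT t : ℝ)) * ε / 2)
    (u : Y × Finset Y → ℝ) (hu : ∀ p, |u p| ≤ 1) :
    ∃ r : SLO Y, ∑ p ∈ allPairs Y, P₀ p.1 p.2 * u p ≤
      ∑ p ∈ allPairs Y, aFn r.1 p.1 p.2 * u p + ε := by
  obtain ⟨m, hm⟩ := Finite.exists_max fun r : SLO Y => ∑ p ∈ allPairs Y, aFn r.1 p.1 p.2 * u p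
  refine ⟨m, ?_⟩
  by_contra! hlt
  set S := ∑ p ∈ allPairs Y, P₀ p.1 p.2 with hS
  obtain ⟨n, hn⟩ := exists_nat_gt (S / (∑ p ∈ allPairs Y, P₀ p.1 p.2 * u p -
    (∑ p ∈ allPairs Y, aFn m.1 p.1 p.2 * u p + ε)))
  rw [div_lt_iff₀ (sub_pos.mpr hlt)] at hn
  have hn0 : (0 : ℝ) ≤ n := n.cast_nonneg
  have hnn : ∀ p, 0 ≤ n * (u p + 1) := fun p =>
    mul_nonneg hn0 (by linarith [neg_le_of_abs_le (hu p)])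
  let t : Y → Finset Y → ℕ := fun y B => ⌊n * (u (y, B) + 1)⌋₊
  obtain ⟨r, hr⟩ := exists_eq_ciSup_of_finite
    (f := fun r : SLO Y => ∑ p ∈ allPairs Y, aFn r.1 p.1 p.2 * t p.1 p.2)
  have key := h t
  rw [← hr] at key
  have hmax : (maxT t : ℝ) ≤ 2 * n := by
    have : maxT t ≤ 2 * n := Finset.sup'_le _ _ fun p _ => Nat.floor_le_of_le (by
      push_cast
      nlinarith [le_of_abs_le (hu p)])
    exact_mod_cast this
  have hmin : (0 : ℝ) ≤ minT t := Nat.cast_nonneg _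
  have hlower : n * ∑ p ∈ allPairs Y, P₀ p.1 p.2 * u p + n * S - S ≤
      ∑ p ∈ allPairs Y, P₀ p.1 p.2 * t p.1 p.2 := by
    rw [hS, Finset.mul_sum, Finset.mul_sum, ← Finset.sum_add_distrib, ← Finset.sum_sub_distrib]
    refine Finset.sum_le_sum fun p hp => ?_
    have hpB : p.1 ∈ p.2 := by simpa [allPairs] using hp
    have hP := (hSCF p.2 ⟨_, hpB⟩).1 p.1 hpB
    nlinarith [Nat.lt_floor_add_one (n * (u p + 1))]
  have hupper : ∑ p ∈ allPairs Y, aFn r.1 p.1 p.2 * t p.1 p.2 ≤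
      n * ∑ p ∈ allPairs Y, aFn r.1 p.1 p.2 * u p + n * S := by
    rw [hS, ← sum_allPairs_aFn hSCF r, Finset.mul_sum, Finset.mul_sum, ← Finset.sum_add_distrib]
    refine Finset.sum_le_sum fun p _ => ?_
    nlinarith [Nat.floor_le (hnn p), aFn_nonneg r.1 p.1 p.2]
  have hrm := mul_le_mul_of_nonneg_left (hm r) hn0
  have hspread : ((maxT t : ℝ) - minT t) * ε ≤ 2 * n * ε :=
    mul_le_mul_of_nonneg_right (by linarith) hε
  linarith

theorem arsp_of_representation {Y : Type*} [Fintype Y] [DecidableEq Y] [Nonempty Y]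
    {P₀ e : Y → Finset Y → ℝ} (hSCF : IsSCF P₀) {ε : ℝ} {π : SLO Y → ℝ}
    (hπ : ∀ r, 0 ≤ π r) (hπ1 : ∑ r, π r = 1) (he : ∑ p ∈ allPairs Y, |e p.1 p.2| ≤ ε)
    (hP : ∀ p ∈ allPairs Y, P₀ p.1 p.2 = (∑ r, π r * aFn r.1 p.1 p.2) + e p.1 p.2)
    (t : Y → Finset Y → ℕ) :
    (∑ p ∈ allPairs Y, P₀ p.1 p.2 * t p.1 p.2) ≤
      (⨆ r : SLO Y, ∑ p ∈ allPairs Y, aFn r.1 p.1 p.2 * t p.1 p.2)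
        + ((maxT t : ℝ) - (minT t : ℝ)) * ε / 2 := by
  have hpair : ∀ f : Y × Finset Y → ℝ, ∑ p ∈ allPairs Y, P₀ p.1 p.2 * f p =
      ∑ r, π r * ∑ p ∈ allPairs Y, aFn r.1 p.1 p.2 * f p +
        ∑ p ∈ allPairs Y, e p.1 p.2 * f p := by
    intro f
    simp only [Finset.mul_sum]
    rw [Finset.sum_comm, ← Finset.sum_add_distrib]
    refine Finset.sum_congr rfl fun p hp => ?_
    rw [hP p hp, add_mul, Finset.sum_mul]
    simp only [mul_assoc]
  have he0 : ∑ p ∈ allPairs Y, e p.1 p.2 = 0 := by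
    have := hpair fun _ => 1
    simp only [mul_one, sum_allPairs_aFn hSCF, ← Finset.sum_mul, hπ1, one_mul] at this
    linarith
  have hmix : ∑ r, π r * ∑ p ∈ allPairs Y, aFn r.1 p.1 p.2 * t p.1 p.2 ≤
      ⨆ r : SLO Y, ∑ p ∈ allPairs Y, aFn r.1 p.1 p.2 * t p.1 p.2 := by
    calc _ ≤ ∑ r, π r * ⨆ r : SLO Y, ∑ p ∈ allPairs Y, aFn r.1 p.1 p.2 * t p.1 p.2 :=
          Finset.sum_le_sum fun r _ => mul_le_mul_of_nonneg_left
            (le_ciSup (f := fun r : SLO Y => ∑ p ∈ allPairs Y, aFn r.1 p.1 p.2 * t p.1 p.2)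
              (Set.finite_range _).bddAbove r) (hπ r)
      _ = _ := by rw [← Finset.sum_mul, hπ1, one_mul]
  have hle : ∀ p ∈ allPairs Y, (t p.1 p.2 : ℝ) ≤ maxT t := fun p hp => by
    exact_mod_cast Finset.le_sup' (fun p : Y × Finset Y => t p.1 p.2) hp
  have hge : ∀ p ∈ allPairs Y, (minT t : ℝ) ≤ t p.1 p.2 := fun p hp => by
    exact_mod_cast Finset.inf'_le (fun p : Y × Finset Y => t p.1 p.2) hp
  have hspread : (0 : ℝ) ≤ ((maxT t : ℝ) - minT t) / 2 := by
    obtain ⟨p, hp⟩ := allPairs_nonempty (Y := Y)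
    linarith [hle p hp, hge p hp]
  have herr : ∑ p ∈ allPairs Y, e p.1 p.2 * t p.1 p.2 ≤ ((maxT t : ℝ) - minT t) * ε / 2 := by
    calc ∑ p ∈ allPairs Y, e p.1 p.2 * t p.1 p.2
        = ∑ p ∈ allPairs Y, e p.1 p.2 * (t p.1 p.2 - ((maxT t : ℝ) + minT t) / 2) := by
          simp only [mul_sub, Finset.sum_sub_distrib, ← Finset.sum_mul, he0, zero_mul, sub_zero]
      _ ≤ ∑ p ∈ allPairs Y, |e p.1 p.2| * (((maxT t : ℝ) - minT t) / 2) := by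
          refine Finset.sum_le_sum fun p hp => (le_abs_self _).trans ?_
          rw [abs_mul]
          refine mul_le_mul_of_nonneg_left (abs_le.mpr ⟨?_, ?_⟩) (abs_nonneg _) <;>
            linarith [hle p hp, hge p hp]
      _ ≤ ε * (((maxT t : ℝ) - minT t) / 2) := by
          rw [← Finset.sum_mul]
          exact mul_le_mul_of_nonneg_right he hspread
      _ = _ := by ring
  rw [hpair fun p => (t p.1 p.2 : ℝ)]
  exact add_le_add hmix herr

theorem stmt12 {Y : Type*} [Fintype Y] [DecidableEq Y] [Nonempty Y]
    (P₀ : Y → Finset Y → ℝ) (hSCF : IsSCF P₀) (ε : ℝ) (hε : 0 ≤ ε) :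
    (∀ t : Y → Finset Y → ℕ,
      (∑ p ∈ allPairs Y, P₀ p.1 p.2 * t p.1 p.2) ≤
        (⨆ r : SLO Y, ∑ p ∈ allPairs Y, aFn r.1 p.1 p.2 * t p.1 p.2)
          + ((maxT t : ℝ) - (minT t : ℝ)) * ε / 2) ↔
    (∃ (e : Y → Finset Y → ℝ) (π : SLO Y → ℝ),
      (∀ r, 0 ≤ π r) ∧ (∑ r : SLO Y, π r) = 1 ∧
      (∑ p ∈ allPairs Y, |e p.1 p.2|) ≤ ε ∧
      ∀ p ∈ allPairs Y, P₀ p.1 p.2 = (∑ r : SLO Y, π r * aFn r.1 p.1 p.2) + e p.1 p.2) := by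
  constructor
  · intro h
    obtain ⟨π, e, hπ, hπ1, he, hP⟩ := exists_convex_combination_add_small_on (allPairs Y)
      (fun (r : SLO Y) p => aFn r.1 p.1 p.2) (fun p => P₀ p.1 p.2) hε
      (exists_pairing_le_of_arsp hSCF hε h)
    exact ⟨fun y B => e (y, B), π, hπ, hπ1, he, hP⟩
  · rintro ⟨e, π, hπ, hπ1, he, hP⟩
    exact arsp_of_representation hSCF hπ hπ1 he hP
end
end

section
/- Let Y be a finite set, D the family of all nonempty subsets of Y, X = {(y, B) : B ∈ D, y ∈ B}, and L the set of strict linear orders on Y, with a_≻(y, B) = 1 if y is the ≻-maximal element of B and 0 otherwise. Let 0 ≤ ε < 2 and let P₀ be a deterministic stochastic choice function, i.e., P₀(y, B) ∈ {0,1} for all (y, B) ∈ X. If P₀ satisfies ε-ARSP (for every t : X → ℕ, Σ P₀(y,B)·t(y,B) ≤ max_{≻ ∈ L} Σ a_≻(y,B)·t(y,B) + (max t − min t)·ε/2), then the choice function induced by P₀ satisfies the Weak Axiom of Revealed Preference: there are no sets B₁, B₂ ∈ D and distinct elements y₁, y₂ with y₁, y₂ ∈ B₁ ∩ B₂, P₀(y₁,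 B₁) = 1, and P₀(y₂, B₂) = 1. -/
noncomputable section

/-- No strict linear order picks both `y₁` from `B₁` and `y₂` from `B₂` when `y₁ ≠ y₂` are both
available in each of the two sets. -/
theorem aFn_add_aFn_le_one {Y : Type*} {r : Y → Y → Prop} (hr : IsStrictTotalOrder Y r)
    {B₁ B₂ : Finset Y} {y₁ y₂ : Y} (hne : y₁ ≠ y₂) (h₁ : y₁ ∈ B₂) (h₂ : y₂ ∈ B₁) :
    aFn r y₁ B₁ + aFn r y₂ B₂ ≤ 1 := by
  unfold aFn
  split_ifs with ha hb
  · exact absurd (hr.trichotomous y₁ y₂ (hb y₁ h₁) (ha y₂ h₂)) hne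
  all_goals norm_num

/-- Summing against the indicator of a two-element set of pairs. -/
theorem sum_allPairs_mul_indicator {Y : Type*} [Fintype Y] [DecidableEq Y]
    (f : Y × Finset Y → ℝ) {p q : Y × Finset Y} (hpq : p ≠ q)
    (hp : p ∈ allPairs Y) (hq : q ∈ allPairs Y) :
    ∑ x ∈ allPairs Y, f x *
        ((if (x.1, x.2) ∈ ({p, q} : Finset (Y × Finset Y)) then 1 else 0 : ℕ) : ℝ)
      = f p + f q := by
  have hsub : ({p, q} : Finset (Y × Finset Y)) ⊆ allPairs Y := by
    simp [Finset.insert_subset_iff, hp, hq]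
  simp only [Nat.cast_ite, Nat.cast_one, Nat.cast_zero, mul_ite, mul_one, mul_zero, Prod.mk.eta]
  rw [← Finset.sum_filter, Finset.filter_mem_eq_inter, Finset.inter_eq_right.mpr hsub,
    Finset.sum_pair hpq]

theorem stmt15 {Y : Type*} [Fintype Y] [DecidableEq Y] [Nonempty Y]
    (P₀ : Y → Finset Y → ℝ) (hSCF : IsSCF P₀)
    (hdet : ∀ p ∈ allPairs Y, P₀ p.1 p.2 = 0 ∨ P₀ p.1 p.2 = 1)
    (ε : ℝ) (hε0 : 0 ≤ ε) (hε2 : ε < 2)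
    (hARSP : ∀ t : Y → Finset Y → ℕ,
      (∑ p ∈ allPairs Y, P₀ p.1 p.2 * t p.1 p.2) ≤
        (⨆ r : SLO Y, ∑ p ∈ allPairs Y, aFn r.1 p.1 p.2 * t p.1 p.2)
          + ((maxT t : ℝ) - (minT t : ℝ)) * ε / 2) :
    ¬ ∃ (B₁ B₂ : Finset Y) (y₁ y₂ : Y), B₁.Nonempty ∧ B₂.Nonempty ∧ y₁ ≠ y₂ ∧
      y₁ ∈ B₁ ∩ B₂ ∧ y₂ ∈ B₁ ∩ B₂ ∧ P₀ y₁ B₁ = 1 ∧ P₀ y₂ B₂ = 1 := by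
  rintro ⟨B₁, B₂, y₁, y₂, -, -, hne, hy₁, hy₂, hP₁, hP₂⟩
  rw [Finset.mem_inter] at hy₁ hy₂
  have hpq : (y₁, B₁) ≠ (y₂, B₂) := fun h => hne (congrArg Prod.fst h)
  have hp : (y₁, B₁) ∈ allPairs Y := by simpa [allPairs] using hy₁.1
  have hq : (y₂, B₂) ∈ allPairs Y := by simpa [allPairs] using hy₂.2
  set t : Y → Finset Y → ℕ := fun y B =>
    if (y, B) ∈ ({(y₁, B₁), (y₂, B₂)} : Finset (Y × Finset Y)) then 1 else 0 with ht
  have key := hARSP t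
  have hsum := sum_allPairs_mul_indicator (fun x => P₀ x.1 x.2) hpq hp hq
  have hsup : (⨆ r : SLO Y, ∑ p ∈ allPairs Y, aFn r.1 p.1 p.2 * t p.1 p.2) ≤ 1 := by
    refine ciSup_le fun r => ?_
    have h := sum_allPairs_mul_indicator (fun x => aFn r.1 x.1 x.2) hpq hp hq
    exact h.trans_le (aFn_add_aFn_le_one r.2 hne hy₁.2 hy₂.1)
  have hmax : (maxT t : ℝ) ≤ 1 := by
    have : maxT t ≤ 1 := Finset.sup'_le _ _ fun x _ => by
      simp only [ht]
      split_ifs <;> simp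
    exact_mod_cast this
  have hmin : (0 : ℝ) ≤ minT t := Nat.cast_nonneg _
  have hbound : ((maxT t : ℝ) - minT t) * ε ≤ 1 * ε :=
    mul_le_mul_of_nonneg_right (by linarith) hε0
  have htwo : (∑ p ∈ allPairs Y, P₀ p.1 p.2 * t p.1 p.2) = 2 := by
    rw [hsum, hP₁, hP₂]
    norm_num
  linarith

end
end
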